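/- Let $k \geq 2$ and let $S, W_0, V_1, \dots, V_{k-1}$ be pairwise disjoint non-empty vertex subsets of a graph $G$ such that every $w \in W_0$ has at least $k^2$ neighbors in $S$. For $i \in \{1,\dots,k-1\}$ and $v \in V_i$, define $W_0(v)$ as the set of $w \in W_0$ for which $G$ contains a path $(w, v_1, \dots, v_{i-1}, v)$ with $v_j \in V_j$ for every $j \in \{1,\dots,i-1\}$. If $|W_0(v)| > 2^{i-1}(k-1)|S|$ for some $i$ and some $v \in V_i$, then $G$ contains a $2k$-cycle intersecting $S$. -/

import Mathlib

open scoped Classical in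
theorem prune {V C : Type*} [Nonempty C] (Adj : V → V → Prop) (W S : Finset V) (R : V → C → Prop)
    (k d : ℕ) (hk : 1 ≤ k)
    (hdeg : ∀ w ∈ W, d + k ≤ (S.filter (fun s => Adj w s)).card) :
    (∃ A T : Finset V, A ⊆ W ∧ T ⊆ S ∧ A.Nonempty ∧
      (∀ w ∈ A, k ≤ (T.filter (fun s => Adj w s)).card) ∧
      (∀ s ∈ T, ∀ b, k ≤ (A.filter (fun w => Adj w s ∧ ¬ R w b)).card)) ∨
    (∃ g : V → C, (W.filter (fun w => ¬ d ≤ (S.filter (fun s => Adj w s ∧ R w (g s))).card)).card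
      ≤ (k - 1) * S.card) := by
  by_contra hcon
  push Not at hcon
  obtain ⟨h1, h2⟩ := hcon
  have key : ∀ n : ℕ, ∀ (A T : Finset V) (g : V → C) (M : V → Finset V), A.card + T.card = n →
      A ⊆ W → T ⊆ S → (∀ s, (M s).card ≤ k - 1) → (∀ s ∈ T, M s = ∅) →
      (∀ w ∈ A, ∀ s ∈ S \ T, Adj w s → R w (g s) ∨ w ∈ M s) →
      (∀ w ∈ W \ A, d ≤ ((S \ T).filter (fun s => Adj w s ∧ R w (g s))).card ∨ ∃ s ∈ S, w ∈ M s) →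
      False := by
    intro n
    induction n using Nat.strong_induction_on with
    | _ n ih =>
    intro A T g M hn hA hT hM hMT hin hout
    by_cases hAe : A.Nonempty
    · by_cases hw : ∃ w ∈ A, (T.filter (fun s => Adj w s)).card < k
      · obtain ⟨w, hwA, hwk⟩ := hw
        refine ih _ ?_ (A.erase w) T g M rfl ((Finset.erase_subset _ _).trans hA) hT hM hMT
          (fun w' hw' => hin w' (Finset.mem_of_mem_erase hw')) ?_
        · have := Finset.card_erase_lt_of_mem hwA
          omega
        · intro w' hw'
          by_cases hww : w' = w
          · subst hww
            by_contra hc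
            push Not at hc
            obtain ⟨hc1, hc2⟩ := hc
            have hsub : S.filter (fun s => Adj w' s) ⊆ T.filter (fun s => Adj w' s) ∪
                (S \ T).filter (fun s => Adj w' s ∧ R w' (g s)) := by
              intro s hs
              simp only [Finset.mem_filter, Finset.mem_union, Finset.mem_sdiff] at hs ⊢
              by_cases hsT : s ∈ T
              · exact Or.inl ⟨hsT, hs.2⟩
              · right
                refine ⟨⟨hs.1, hsT⟩, hs.2, ?_⟩
                rcases hin w' hwA s (by simp [hs.1, hsT]) hs.2 with h | h
                · exact h
                · exact absurd h (hc2 s hs.1)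
            have h3 := Finset.card_le_card hsub
            have h4 := Finset.card_union_le (T.filter (fun s => Adj w' s))
                ((S \ T).filter (fun s => Adj w' s ∧ R w' (g s)))
            have h5 := hdeg w' (hA hwA)
            omega
          · apply hout
            simp only [Finset.mem_sdiff, Finset.mem_erase] at hw' ⊢
            tauto
      · push Not at hw
        obtain ⟨s, hsT, b, hb⟩ := h1 A T hA hT hAe hw
        refine ih _ ?_ A (T.erase s) (Function.update g s b)
          (Function.update M s (A.filter (fun w => Adj w s ∧ ¬ R w b))) rfl hA
          ((Finset.erase_subset _ _).trans hT) ?_ ?_ ?_ ?_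
        · have := Finset.card_erase_lt_of_mem hsT
          omega
        · intro s'
          by_cases h : s' = s
          · subst h
            simp only [Function.update_self]
            omega
          · simp only [Function.update_of_ne h]
            exact hM s'
        · intro s' hs'
          rw [Function.update_of_ne (Finset.ne_of_mem_erase hs')]
          exact hMT s' (Finset.mem_of_mem_erase hs')
        · intro w hwA s' hs' hadj
          by_cases h : s' = s
          · subst h
            simp only [Function.update_self, Finset.mem_filter]
            tauto
          · simp only [Function.update_of_ne h]
            apply hin w hwA s' _ hadj
            simp only [Finset.mem_sdiff, Finset.mem_erase] at hs' ⊢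
            tauto
        · intro w hw
          rcases hout w hw with h | ⟨s', hs', hwM⟩
          · left
            refine h.trans (Finset.card_le_card ?_)
            intro s' hs'
            simp only [Finset.mem_filter, Finset.mem_sdiff, Finset.mem_erase] at hs' ⊢
            have hne : s' ≠ s := fun h => hs'.1.2 (h ▸ hsT)
            simp only [Function.update_of_ne hne]
            tauto
          · right
            have hne : s' ≠ s := by
              rintro rfl
              simp [hMT s' hsT] at hwM
            exact ⟨s', hs', by simpa only [Function.update_of_ne hne] using hwM⟩
    · rw [Finset.not_nonempty_iff_eq_empty] at hAe
      subst hAe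
      have h2' := h2 g
      simp only [← not_le] at h2'
      refine h2' ?_
      have hsub : (W.filter (fun w => ¬ d ≤ (S.filter (fun s => Adj w s ∧ R w (g s))).card)) ⊆
          S.biUnion M := by
        intro w hw
        simp only [Finset.mem_filter, Finset.mem_biUnion] at hw ⊢
        rcases hout w (by simp [hw.1]) with h | h
        · refine absurd (h.trans (Finset.card_le_card ?_)) hw.2
          exact Finset.filter_subset_filter _ Finset.sdiff_subset
        · exact h
      calc _ ≤ _ := Finset.card_le_card hsub
        _ ≤ _ := Finset.card_biUnion_le_card_mul _ _ _ (fun s _ => hM s)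
        _ = _ := mul_comm _ _
  exact key _ W S (fun _ => Classical.arbitrary C) (fun _ => ∅) rfl subset_rfl subset_rfl
    (by simp) (by simp) (by simp) (by simp)

/-- Greedy construction of an alternating path. -/
theorem altpath {V C : Type*} (G : SimpleGraph V) (A T : Finset V) (hAT : Disjoint A T)
    (R : V → C → Prop) (k : ℕ) (w0 : V) (hw0 : w0 ∈ A) (b : C)
    (h1 : ∀ w ∈ A, ∃ U : Finset V, U ⊆ T ∧ k ≤ U.card ∧ ∀ s ∈ U, G.Adj w s)
    (h2 : ∀ s ∈ T, ∃ U : Finset V, U ⊆ A ∧ k ≤ U.card ∧ ∀ w ∈ U, G.Adj w s ∧ ¬ R w b) :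
    ∀ m : ℕ, m < k → ∃ (w : V) (p : G.Walk w0 w) (UA UT : Finset V), p.IsPath ∧ p.length = 2 * m ∧
      w ∈ A ∧ UA ⊆ A ∧ UT ⊆ T ∧ UA.card ≤ m + 1 ∧ UT.card ≤ m ∧
      (∀ x ∈ p.support, x ∈ UA ∨ x ∈ UT) ∧
      (1 ≤ m → ¬ R w b ∧ ∃ s ∈ T, s ∈ p.support) := by
  classical
  intro m
  induction m with
  | zero =>
    intro _
    exact ⟨w0, .nil, {w0}, ∅, by simp, by simp, hw0, by simpa using hw0, by simp, by simp, by simp,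
      by simp, by simp⟩
  | succ m ih =>
    intro hm
    obtain ⟨w, p, UA, UT, hp, hl, hwA, hUA, hUT, hcA, hcT, hsup, -⟩ := ih (by omega)
    obtain ⟨X, hX, hXc, hXa⟩ := h1 w hwA
    obtain ⟨s, hsX, hsU⟩ : ∃ s ∈ X, s ∉ UT :=
      Finset.exists_mem_notMem_of_card_lt_card (by omega)
    obtain ⟨Y, hY, hYc, hYa⟩ := h2 s (hX hsX)
    obtain ⟨w', hwY, hwU⟩ : ∃ w' ∈ Y, w' ∉ UA :=
      Finset.exists_mem_notMem_of_card_lt_card (by omega)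
    have hsT := hX hsX
    have hw'A := hY hwY
    have hd := Finset.disjoint_left.1 hAT
    have hs1 : s ∉ p.support := by
      intro h
      rcases hsup s h with h | h
      · exact hd (hUA h) hsT
      · exact hsU h
    have hw1 : w' ∉ (p.concat (hXa s hsX)).support := by
      intro h
      rw [SimpleGraph.Walk.support_concat] at h
      simp only [List.concat_eq_append, List.mem_append, List.mem_singleton] at h
      rcases h with h | h
      · rcases hsup _ h with h | h
        · exact hwU h
        · exact hd hw'A (hUT h)
      · exact hd hw'A (h ▸ hsT)
    refine ⟨w', (p.concat (hXa s hsX)).concat (hYa w' hwY).1.symm, insert w' UA, insert s UT,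
      (hp.concat hs1 _).concat hw1 _, ?_, hw'A, ?_, ?_, ?_, ?_, ?_, ?_⟩
    · simp [hl]; ring
    · exact Finset.insert_subset hw'A hUA
    · exact Finset.insert_subset hsT hUT
    · exact (Finset.card_insert_le _ _).trans (by omega)
    · exact (Finset.card_insert_le _ _).trans (by omega)
    · intro x hx
      simp only [SimpleGraph.Walk.support_concat, List.concat_eq_append, List.mem_append,
        List.mem_singleton] at hx
      simp only [Finset.mem_insert]
      rcases hx with (h | h) | h
      · rcases hsup x h with h | h <;> simp [h]
      · simp [h]
      · simp [h]
    · intro _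
      exact ⟨(hYa w' hwY).2, s, hsT, by simp [SimpleGraph.Walk.support_concat]⟩

theorem append_path {V : Type*} {G : SimpleGraph V} {u v w : V} (p : G.Walk u v) (q : G.Walk v w)
    (hp : p.IsPath) (hq : q.IsPath) (h : ∀ x ∈ p.support, x ∈ q.support → x = v) :
    (p.append q).IsPath := by
  rw [SimpleGraph.Walk.isPath_def] at *
  rw [SimpleGraph.Walk.support_append, List.nodup_append]
  have h3 := SimpleGraph.Walk.support_eq_cons q
  rw [h3] at hq
  refine ⟨hp, (List.nodup_cons.1 hq).2, ?_⟩
  rintro a ha c hc rfl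
  have := h a ha (List.mem_of_mem_tail hc)
  subst this
  exact (List.nodup_cons.1 hq).1 hc

theorem chain_path {V : Type*} {G : SimpleGraph V} (par : V → V) (x : V) (n : ℕ)
    (h : ∀ j < n, G.Adj (par^[j] x) (par^[j+1] x))
    (hinj : ∀ a ≤ n, ∀ b ≤ n, par^[a] x = par^[b] x → a = b) :
    ∃ q : G.Walk x (par^[n] x), q.IsPath ∧ q.length = n ∧ ∀ y ∈ q.support, ∃ j ≤ n, y = par^[j] x := by
  induction n with
  | zero => exact ⟨.nil, by simp, by simp, by simp⟩
  | succ n ih =>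
    obtain ⟨q, hq, hl, hs⟩ := ih (fun j hj => h j (by omega))
      (fun a ha b hb => hinj a (by omega) b (by omega))
    refine ⟨q.concat (h n (by omega)), hq.concat ?_ _, by rw [SimpleGraph.Walk.length_concat, hl], ?_⟩
    · intro hmem
      obtain ⟨j, hj, he⟩ := hs _ hmem
      have := hinj _ le_rfl j (by omega) he
      omega
    · intro y hy
      simp only [SimpleGraph.Walk.support_concat, List.concat_eq_append, List.mem_append,
        List.mem_singleton] at hy
      rcases hy with hy | hy
      · obtain ⟨j, hj, he⟩ := hs _ hy
        exact ⟨j, by omega, he⟩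
      · exact ⟨n + 1, le_rfl, hy⟩

theorem close_cycle {V : Type*} {G : SimpleGraph V} (k i : ℕ) (hi : 1 ≤ i) (hik : i < k)
    (S : Finset V) (L : ℕ → Finset V) (par : V → V) (v : V)
    (hLL : ∀ a < k, ∀ b < k, ∀ x, x ∈ L a → x ∈ L b → a = b)
    (hSL : ∀ a < k, ∀ x ∈ S, x ∉ L a)
    (w1 w2 : V)
    (hp1 : ∀ j < i, G.Adj (par^[j] w1) (par^[j+1] w1))
    (hp2 : ∀ j < i, G.Adj (par^[j] w2) (par^[j+1] w2))
    (hl1 : ∀ j ≤ i, par^[j] w1 ∈ L j) (hl2 : ∀ j ≤ i, par^[j] w2 ∈ L j)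
    (he1 : par^[i] w1 = v) (he2 : par^[i] w2 = v)
    (hne : par^[i-1] w1 ≠ par^[i-1] w2)
    (p : G.Walk w1 w2) (hp : p.IsPath) (hpl : p.length = 2 * (k - i))
    (hps : ∀ x ∈ p.support, x ∈ L 0 ∨ x ∈ S) (hs : ∃ s ∈ S, s ∈ p.support) :
    ∃ (x : V) (c : G.Walk x x), c.IsCycle ∧ c.length = 2 * k ∧ ∃ s ∈ S, s ∈ c.support := by
  obtain ⟨q1, hq1, hql1, hqs1⟩ := chain_path (G := G) par w1 (i-1) (fun j hj => hp1 j (by omega))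
    (fun a ha b hb h => hLL a (by omega) b (by omega) _ (hl1 a (by omega))
      (h ▸ hl1 b (by omega)))
  obtain ⟨q2, hq2, hql2, hqs2⟩ := chain_path (G := G) par w2 i hp2
    (fun a ha b hb h => hLL a (by omega) b (by omega) _ (hl2 a (by omega))
      (h ▸ hl2 b (by omega)))
  have hpq2 : (p.append q2).IsPath := by
    refine append_path p q2 hp hq2 ?_
    intro x hx hx2
    obtain ⟨j, hj, rfl⟩ := hqs2 x hx2
    rcases hps _ hx with h | h
    · have : j = 0 := hLL j (by omega) 0 (by omega) _ (hl2 j hj) h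
      subst this
      rfl
    · exact absurd (hl2 j hj) (hSL j (by omega) _ h)
  have hP : (q1.reverse.append (p.append q2)).IsPath := by
    refine append_path _ _ hq1.reverse hpq2 ?_
    intro x hx hx2
    rw [SimpleGraph.Walk.support_reverse, List.mem_reverse] at hx
    obtain ⟨j, hj, rfl⟩ := hqs1 x hx
    rw [SimpleGraph.Walk.mem_support_append_iff] at hx2
    rcases hx2 with hx2 | hx2
    · rcases hps _ hx2 with h | h
      · have : j = 0 := hLL j (by omega) 0 (by omega) _ (hl1 j (by omega)) h
        subst this
        rfl
      · exact absurd (hl1 j (by omega)) (hSL j (by omega) _ h)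
    · exfalso
      obtain ⟨j', hj', he⟩ := hqs2 _ hx2
      have : j = j' := hLL j (by omega) j' (by omega) _ (hl1 j (by omega)) (he ▸ hl2 j' hj')
      subst this
      apply hne
      have h3 : i - 1 = (i - 1 - j) + j := by omega
      rw [h3, Function.iterate_add_apply, Function.iterate_add_apply, he]
  have hadj : G.Adj (par^[i] w2) (par^[i-1] w1) := by
    have := hp1 (i-1) (by omega)
    rw [show i - 1 + 1 = i by omega, he1, ← he2] at this
    exact this.symm
  have hlen : (q1.reverse.append (p.append q2)).length = 2 * k - 1 := by
    simp [hql1, hql2, hpl]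
    omega
  refine ⟨_, SimpleGraph.Walk.cons hadj (q1.reverse.append (p.append q2)), ?_, ?_, ?_⟩
  · rw [SimpleGraph.Walk.cons_isCycle_iff]
    refine ⟨hP, fun h => ?_⟩
    rw [Sym2.eq_swap] at h
    have := hP.length_eq_one_of_mem_edges h
    omega
  · rw [SimpleGraph.Walk.length_cons, hlen]
    omega
  · obtain ⟨s, hsS, hsp⟩ := hs
    refine ⟨s, hsS, ?_⟩
    simp [SimpleGraph.Walk.mem_support_append_iff, hsp]

open scoped Classical in
theorem main_ind {V : Type*} (G : SimpleGraph V) (k : ℕ) 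
    (S0 : Finset V) (L : ℕ → Finset V) (par : V → V)
    (hLL : ∀ a < k, ∀ b < k, ∀ x, x ∈ L a → x ∈ L b → a = b)
    (hSL : ∀ a < k, ∀ x ∈ S0, x ∉ L a)
    (hno : ¬ ∃ (x : V) (c : G.Walk x x), c.IsCycle ∧ c.length = 2 * k ∧ ∃ s ∈ S0, s ∈ c.support) :
    ∀ i, i + 1 < k → ∀ (v : V) (S W : Finset V), S ⊆ S0 →
    (∀ w ∈ W, ∀ j < i + 1, G.Adj (par^[j] w) (par^[j+1] w)) →
    (∀ w ∈ W, ∀ j ≤ i + 1, par^[j] w ∈ L j) → (∀ w ∈ W, par^[i+1] w = v) →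
    (∀ w ∈ W, (i + 1) * k + 1 ≤ (S.filter (fun s => G.Adj w s)).card) →
    W.card ≤ (i + 1) * (k - 1) * S.card := by
  -- the first alternative of `prune` gives a cycle
  have good : ∀ (R : V → V → Prop) (f : V → V) (i : ℕ) (_ : i + 1 < k) (v : V)
    (S W : Finset V) (_ : S ⊆ S0)
    (_ : ∀ w ∈ W, ∀ j < i + 1, G.Adj (par^[j] w) (par^[j+1] w))
    (_ : ∀ w ∈ W, ∀ j ≤ i + 1, par^[j] w ∈ L j) (_ : ∀ w ∈ W, par^[i+1] w = v)
    (_ : ∀ w1 ∈ W, ∀ w2 ∈ W, w1 ≠ w2 → ¬ R w2 (f w1) → par^[i] w1 ≠ par^[i] w2)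
    (A T : Finset V) (_ : A ⊆ W) (_ : T ⊆ S) (_ : A.Nonempty)
    (_ : ∀ w ∈ A, k ≤ (T.filter (fun s => G.Adj w s)).card)
    (_ : ∀ s ∈ T, ∀ b, k ≤ (A.filter (fun w => G.Adj w s ∧ ¬ R w b)).card), False := by
    intro R f i hik v S W hS hadj hlay hend hbr A T hA hT hAne h1 h2
    obtain ⟨w1, hw1⟩ := hAne
    have hAT : Disjoint A T := by
      rw [Finset.disjoint_left]
      intro x hx hx2
      exact hSL 0 (by omega) x (hS (hT hx2)) (hlay x (hA hx) 0 (by omega))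
    obtain ⟨w2, p, UA, UT, hp, hpl, hw2, hUA, hUT, -, -, hsup, hm⟩ :=
      altpath G A T hAT R k w1 hw1 (f w1)
        (fun w hw => ⟨_, Finset.filter_subset _ _, h1 w hw, fun s hs => (Finset.mem_filter.1 hs).2⟩)
        (fun s hs => ⟨_, Finset.filter_subset _ _, h2 s hs (f w1),
          fun s hs => (Finset.mem_filter.1 hs).2⟩) (k - (i+1)) (by omega)
    obtain ⟨hR, s, hsT, hsp⟩ := hm (by omega)
    have hne : w1 ≠ w2 := by
      rintro rfl
      rw [SimpleGraph.Walk.isPath_iff_eq_nil] at hp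
      subst hp
      simp at hpl
      omega
    apply hno
    refine close_cycle k (i+1) (by omega) hik S0 L par v hLL hSL w1 w2 (hadj _ (hA hw1))
      (hadj _ (hA hw2)) (hlay _ (hA hw1)) (hlay _ (hA hw2)) (hend _ (hA hw1)) (hend _ (hA hw2))
      ?_ p hp hpl ?_ ⟨s, hS (hT hsT), hsp⟩
    · exact hbr w1 (hA hw1) w2 (hA hw2) hne hR
    · intro x hx
      rcases hsup x hx with h | h
      · exact Or.inl (hlay x (hA (hUA h)) 0 (by omega))
      · exact Or.inr (hS (hT (hUT h)))
  intro i
  induction i with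
  | zero =>
    intro hik v S W hS hadj hlay hend hdeg
    have : Nonempty V := ⟨v⟩
    rcases prune G.Adj W S (fun (_ : V) (_ : V) => False) k 1 (by omega)
      (fun w hw => by have := hdeg w hw; omega) with ⟨A, T, hA, hT, hAne, h1, h2⟩ | ⟨g, hg⟩
    · exact (good _ id 0 hik v S W hS hadj hlay hend (fun w1 _ w2 _ h _ => h)
        A T hA hT hAne h1 h2).elim
    · simpa using hg
  | succ i ih =>
    intro hik v S W hS hadj hlay hend hdeg
    by_cases hWe : W.Nonempty
    swap
    · rw [Finset.not_nonempty_iff_eq_empty] at hWe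
      simp [hWe]
    have : Nonempty V := ⟨v⟩
    rcases prune G.Adj W S (fun (w : V) (b : V) => par^[i+1] w = b) k ((i+1)*k+1) (by omega)
      (fun w hw => by have := hdeg w hw; nlinarith) with ⟨A, T, hA, hT, hAne, h1, h2⟩ | ⟨g, hg⟩
    · exact (good _ (fun w => par^[i+1] w) (i+1) hik v S W hS hadj hlay hend
        (fun w1 _ w2 _ _ h h' => h h'.symm) A T hA hT hAne h1 h2).elim
    · set P : V → Prop := fun w =>
        (i+1)*k+1 ≤ (S.filter (fun s => G.Adj w s ∧ par^[i+1] w = g s)).card with hP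
      have hsplit := Finset.card_filter_add_card_filter_not (s := W) P
      have hI : (W.filter P).card ≤ (i+1) * (k-1) * S.card := by
        have e1 : (W.filter P).card = ∑ b ∈ S.image g,
            ((W.filter P).filter (fun w => par^[i+1] w = b)).card := by
          apply Finset.card_eq_sum_card_fiberwise
          intro w hw
          simp only [Finset.coe_filter, Set.mem_setOf_eq, hP] at hw
          obtain ⟨s, hs⟩ := Finset.card_pos.1 (lt_of_lt_of_le (Nat.succ_pos _) hw.2)
          rw [Finset.mem_filter] at hs
          simp only [Finset.coe_image, Set.mem_image, Finset.mem_coe]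
          exact ⟨s, hs.1, hs.2.2.symm⟩
        have e2 : S.card = ∑ b ∈ S.image g, (S.filter (fun s => g s = b)).card := by
          apply Finset.card_eq_sum_card_fiberwise
          intro s hs
          simpa using ⟨s, hs, rfl⟩
        rw [e1, e2, Finset.mul_sum]
        apply Finset.sum_le_sum
        intro b _
        apply ih (by omega) b
        · exact (Finset.filter_subset _ _).trans hS
        · intro w hw j hj
          simp only [Finset.mem_filter] at hw
          exact hadj w hw.1.1 j (by omega)
        · intro w hw j hj
          simp only [Finset.mem_filter] at hw
          exact hlay w hw.1.1 j (by omega)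
        · intro w hw
          exact (Finset.mem_filter.1 hw).2
        · intro w hw
          simp only [Finset.mem_filter, hP] at hw
          refine hw.1.2.trans (Finset.card_le_card ?_)
          intro s hs
          simp only [Finset.mem_filter] at hs ⊢
          exact ⟨⟨hs.1, hs.2.2.symm.trans hw.2⟩, hs.2.1⟩
      have hII : (W.filter (fun w => ¬ P w)).card ≤ (k-1) * S.card := hg
      calc W.card ≤ (i+1) * (k-1) * S.card + (k-1) * S.card := by omega
        _ = _ := by ring

open scoped Classical in
theorem exists_par {V : Type*} (G : SimpleGraph V) (k i : ℕ) (hik : i < k) (L : ℕ → Finset V)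
    (hLL : ∀ a < k, ∀ b < k, ∀ x, x ∈ L a → x ∈ L b → a = b) (v : V) :
    ∃ par : V → V, ∀ w, (∃ p : G.Walk w v, p.length = i ∧ ∀ j ≤ i, p.getVert j ∈ L j) →
      (∀ j < i, G.Adj (par^[j] w) (par^[j+1] w)) ∧ (∀ j ≤ i, par^[j] w ∈ L j) ∧ par^[i] w = v := by
  let Good : ℕ → V → Prop := fun j y => ∃ q : G.Walk y v, q.length + j = i ∧
    ∀ t, j + t ≤ i → q.getVert t ∈ L (j + t)
  let Q : V → V → Prop := fun x y => ∃ j < i, x ∈ L j ∧ G.Adj x y ∧ Good (j+1) y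
  let par : V → V := fun x => if h : ∃ y, Q x y then h.choose else x
  have hmem : ∀ j y, j ≤ i → Good j y → y ∈ L j := by
    rintro j y hj ⟨q, _, h⟩
    simpa using h 0 (by omega)
  have hstep : ∀ j x, j < i → Good j x → G.Adj x (par x) ∧ Good (j+1) (par x) := by
    intro j x hj hg
    have hxj := hmem j x hj.le hg
    have hex : ∃ y, Q x y := by
      obtain ⟨q, hl, h⟩ := hg
      cases q with
      | nil => simp at hl; omega
      | cons hadj q =>
        rename_i y
        refine ⟨y, j, hj, hxj, hadj, q, ?_, ?_⟩
        · rw [SimpleGraph.Walk.length_cons] at hl; omega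
        · intro t ht
          have := h (t+1) (by omega)
          rw [SimpleGraph.Walk.getVert_cons_succ] at this
          rwa [show j + 1 + t = j + (t + 1) by omega]
    have hpx : par x = hex.choose := dif_pos hex
    obtain ⟨j', hj', hx', ha, hg'⟩ := hex.choose_spec
    have : j' = j := hLL j' (by omega) j (by omega) x hx' hxj
    subst this
    rw [hpx]
    exact ⟨ha, hg'⟩
  refine ⟨par, ?_⟩
  rintro w ⟨p, hpl, hp⟩
  have hall : ∀ j, j ≤ i → Good j (par^[j] w) := by
    intro j
    induction j with
    | zero => exact fun _ => ⟨p, by simpa using hpl, fun t ht => by simpa using hp t (by omega)⟩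
    | succ j ih =>
      intro hj
      rw [Function.iterate_succ_apply']
      exact (hstep j _ (by omega) (ih (by omega))).2
  refine ⟨?_, ?_, ?_⟩
  · intro j hj
    rw [Function.iterate_succ_apply']
    exact (hstep j _ hj (hall j hj.le)).1
  · exact fun j hj => hmem j _ hj (hall j hj)
  · obtain ⟨q, hq, -⟩ := hall i le_rfl
    exact SimpleGraph.Walk.eq_of_length_eq_zero (p := q) (by omega)



open scoped Classical in
theorem stmt4 {V : Type*} [Fintype V]
    (G : SimpleGraph V)
    (k : ℕ) (hk : 2 ≤ k) (S W0 : Finset V) (Vs : ℕ → Finset V)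
    (hS : S.Nonempty) (hW0 : W0.Nonempty)
    (hVs : ∀ j ∈ Finset.Icc 1 (k - 1), (Vs j).Nonempty)
    (hd1 : Disjoint S W0)
    (hd2 : ∀ j ∈ Finset.Icc 1 (k - 1), Disjoint S (Vs j) ∧ Disjoint W0 (Vs j))
    (hd3 : ∀ j ∈ Finset.Icc 1 (k - 1), ∀ j' ∈ Finset.Icc 1 (k - 1), j ≠ j' →
      Disjoint (Vs j) (Vs j'))
    (hdeg : ∀ w ∈ W0, k ^ 2 ≤ (S.filter (fun s => G.Adj w s)).card)
    (hbig : ∃ i ∈ Finset.Icc 1 (k - 1), ∃ v ∈ Vs i,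
      2 ^ (i - 1) * (k - 1) * S.card <
        (W0.filter (fun w => ∃ p : G.Walk w v, p.IsPath ∧ p.length = i ∧
          ∀ j ∈ Finset.Ico 1 i, p.getVert j ∈ Vs j)).card) :
    ∃ (x : V) (c : G.Walk x x), c.IsCycle ∧ c.length = 2 * k ∧
      ∃ s ∈ S, s ∈ c.support := by
  obtain ⟨i, hi, v, hv, hlt⟩ := hbig
  rw [Finset.mem_Icc] at hi
  by_contra hno
  let L : ℕ → Finset V := fun j => if j = 0 then W0 else Vs j
  have hL0 : L 0 = W0 := rfl
  have hLp : ∀ j, j ≠ 0 → L j = Vs j := fun j hj => if_neg hj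
  have hLL : ∀ a < k, ∀ b < k, ∀ x, x ∈ L a → x ∈ L b → a = b := by
    intro a ha b hb x hxa hxb
    by_contra hne
    by_cases ha0 : a = 0
    · subst ha0
      have hb0 : b ≠ 0 := fun h => hne h.symm
      rw [hLp b hb0] at hxb
      exact Finset.disjoint_left.1 (hd2 b (Finset.mem_Icc.2 (by omega))).2 hxa hxb
    · rw [hLp a ha0] at hxa
      by_cases hb0 : b = 0
      · subst hb0
        exact Finset.disjoint_left.1 (hd2 a (Finset.mem_Icc.2 (by omega))).2 hxb hxa
      · rw [hLp b hb0] at hxb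
        exact Finset.disjoint_left.1 (hd3 a (Finset.mem_Icc.2 (by omega)) b
          (Finset.mem_Icc.2 (by omega)) hne) hxa hxb
  have hSL : ∀ a < k, ∀ x ∈ S, x ∉ L a := by
    intro a ha x hx hxa
    by_cases ha0 : a = 0
    · subst ha0
      exact Finset.disjoint_left.1 hd1 hx hxa
    · rw [hLp a ha0] at hxa
      exact Finset.disjoint_left.1 (hd2 a (Finset.mem_Icc.2 (by omega))).1 hx hxa
  obtain ⟨par, hpar⟩ := exists_par G k i (by omega) L hLL v
  obtain ⟨n, rfl⟩ : ∃ n, i = n + 1 := ⟨i - 1, by omega⟩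
  have hpar' : ∀ w ∈ (W0.filter (fun w => ∃ p : G.Walk w v, p.IsPath ∧ p.length = n + 1 ∧
          ∀ j ∈ Finset.Ico 1 (n + 1), p.getVert j ∈ Vs j)),
      (∀ j < n + 1, G.Adj (par^[j] w) (par^[j+1] w)) ∧ (∀ j ≤ n + 1, par^[j] w ∈ L j) ∧
        par^[n + 1] w = v := by
    intro w hw
    obtain ⟨hw0, p, -, hl, hp⟩ := Finset.mem_filter.1 hw
    refine hpar w ⟨p, hl, ?_⟩
    intro j hj
    by_cases hj0 : j = 0
    · subst hj0
      rw [SimpleGraph.Walk.getVert_zero]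
      exact hw0
    · rw [hLp j hj0]
      by_cases hj1 : j = n + 1
      · subst hj1
        rw [← hl, SimpleGraph.Walk.getVert_length, hl]
        exact hv
      · exact hp j (Finset.mem_Ico.2 (by omega))
  have hmain := main_ind G k S L par hLL hSL hno n (by omega) v S _ subset_rfl
    (fun w hw => (hpar' w hw).1) (fun w hw => (hpar' w hw).2.1) (fun w hw => (hpar' w hw).2.2)
    (fun w hw => by
      have h1 := hdeg w (Finset.mem_filter.1 hw).1
      have h2 : (n + 1 + 1) * k ≤ k * k := Nat.mul_le_mul_right _ (by omega)
      nlinarith)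
  have h3 : (n + 1) * (k - 1) * S.card ≤ 2 ^ (n + 1 - 1) * (k - 1) * S.card := by
    have : n + 1 ≤ 2 ^ n := Nat.lt_two_pow_self
    rw [Nat.add_sub_cancel]
    gcongr
  omega
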